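/- Let d ≥ 1, γ > 0, and let f_I ∈ C¹(ℝ^d) ∩ L^∞(ℝ^d) with f_I ≥ 0 be radially symmetric and radially non-increasing, not identically zero. Then the maximal time of existence of the C¹ solution ρ of ∂_t ρ − (1+γ) ρ^γ x · ∇_x ρ = d ρ^{1+γ} with ρ(·,0) = f_I equals t* = (γ d (sup f_I)^γ)^{-1}, and the solution blows up at the origin: ρ(x,t) → +∞ as (x,t) → (0, t*). -/

import Mathlib

open Real Set Filter

/-- `ρ` is a `C¹` solution on `ℝ^d × [0, tstar)` of the non-conservative scaled drift
equation `∂_t ρ − (1+γ) ρ^γ x·∇_x ρ = d ρ^{1+γ}` with initial datum `f_I`. -/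
def IsC1DriftSol (d : ℕ) (γ : ℝ) (f_I : EuclideanSpace ℝ (Fin d) → ℝ)
    (tstar : ℝ) (ρ : EuclideanSpace ℝ (Fin d) × ℝ → ℝ) : Prop :=
  ContDiffOn ℝ 1 ρ (univ ×ˢ Ico 0 tstar) ∧
  (∀ x, ρ (x, 0) = f_I x) ∧
  (∀ x : EuclideanSpace ℝ (Fin d), ∀ t ∈ Ico (0:ℝ) tstar,
    derivWithin (fun s => ρ (x, s)) (Ico 0 tstar) t
      - (1+γ) * (ρ (x, t)) ^ γ * (inner (𝕜 := ℝ) x (gradient (fun y => ρ (y, t)) x))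
      = (d : ℝ) * (ρ (x, t)) ^ (1+γ))

open Topology Asymptotics

section Aux

variable {E : Type*} [NormedAddCommGroup E] [NormedSpace ℝ E]

lemma drift_mm_pos {γ c T M t a : ℝ} (hγ : 0 < γ) (hc : 0 < c) (hM : 0 < M)
    (hT : c * T * M ^ γ = 1) (ht0 : 0 ≤ t) (htT : t < T) (ha0 : 0 ≤ a) (haM : a ≤ M) :
    0 < 1 - c * t * a ^ γ := by
  have h1 : a ^ γ ≤ M ^ γ := Real.rpow_le_rpow ha0 haM hγ.le
  have h2 : 0 < M ^ γ := Real.rpow_pos_of_pos hM γ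
  have h3 : c * t * a ^ γ ≤ c * t * M ^ γ := mul_le_mul_of_nonneg_left h1 (by positivity)
  have h4 : c * t * M ^ γ < c * T * M ^ γ := by gcongr
  linarith

lemma drift_anti {γ c β T M t a a' : ℝ} {f : E → ℝ}
    (hanti : ∀ x y : E, ‖x‖ ≤ ‖y‖ → f y ≤ f x)
    (hγ : 0 < γ) (hc : 0 < c) (hβ : 0 < β) (hM : 0 < M)
    (hT : c * T * M ^ γ = 1) (ht0 : 0 ≤ t) (htT : t < T) (ha0 : 0 ≤ a) (haa : a ≤ a')
    (haM : a' ≤ M) (x : E) :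
    f ((1 - c * t * a' ^ γ) ^ (-β) • x) ≤ f ((1 - c * t * a ^ γ) ^ (-β) • x) := by
  have hp := drift_mm_pos hγ hc hM hT ht0 htT ha0 (haa.trans haM)
  have hp' := drift_mm_pos hγ hc hM hT ht0 htT (ha0.trans haa) haM
  apply hanti
  rw [norm_smul, norm_smul]
  apply mul_le_mul_of_nonneg_right _ (norm_nonneg _)
  rw [Real.norm_of_nonneg (by positivity), Real.norm_of_nonneg (by positivity)]
  apply Real.rpow_le_rpow_of_nonpos hp' _ (by linarith)
  have h1 : a ^ γ ≤ a' ^ γ := Real.rpow_le_rpow ha0 haa hγ.le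
  have h3 : c * t * a ^ γ ≤ c * t * a' ^ γ := mul_le_mul_of_nonneg_left h1 (by positivity)
  linarith

lemma drift_root {γ c β T M t : ℝ} {f : E → ℝ} (hf : Continuous f) (hnn : ∀ x, 0 ≤ f x)
    (hfM : ∀ x, f x ≤ M)
    (hγ : 0 < γ) (hc : 0 < c) (hM : 0 < M)
    (hT : c * T * M ^ γ = 1) (ht0 : 0 ≤ t) (htT : t < T) (x : E) :
    ∃ a, 0 ≤ a ∧ a ≤ M ∧ a = f ((1 - c * t * a ^ γ) ^ (-β) • x) := by
  have hcont : ContinuousOn (fun a : ℝ => a - f ((1 - c * t * a ^ γ) ^ (-β) • x)) (Icc 0 M) := by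
    apply continuousOn_id.sub
    apply hf.comp_continuousOn
    apply ContinuousOn.smul _ continuousOn_const
    apply ContinuousOn.rpow_const
    · apply continuousOn_const.sub
      apply continuousOn_const.mul
      exact continuousOn_id.rpow_const (fun a _ => Or.inr hγ.le)
    · intro a ha
      exact Or.inl (drift_mm_pos hγ hc hM hT ht0 htT ha.1 ha.2).ne'
  have h := intermediate_value_Icc hM.le hcont
  have h0 : (0:ℝ) ∈ Icc ((0:ℝ) - f ((1 - c * t * 0 ^ γ) ^ (-β) • x))
      (M - f ((1 - c * t * M ^ γ) ^ (-β) • x)) :=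
    ⟨by linarith [hnn ((1 - c * t * 0 ^ γ) ^ (-β) • x)],
     by linarith [hfM ((1 - c * t * M ^ γ) ^ (-β) • x)]⟩
  obtain ⟨a, ha, hae⟩ := h h0
  exact ⟨a, ha.1, ha.2, by simp only at hae; linarith⟩

lemma implicit_deriv {F : Type*} [NormedAddCommGroup F] [NormedSpace ℝ F]
    {s : Set F} {p : F} {a : F → ℝ} {H : F × ℝ → ℝ} {H' : F × ℝ →L[ℝ] ℝ}
    (hp : p ∈ s) (ha : ContinuousWithinAt a s p) (heq : ∀ q ∈ s, a q = H (q, a q))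
    (hH : HasFDerivAt H H' (p, a p)) (hB : 1 - H' (0, 1) ≠ 0) :
    HasFDerivWithinAt a ((1 - H' (0, 1))⁻¹ • H'.comp (ContinuousLinearMap.inl ℝ F ℝ)) s p := by
  set B := 1 - H' (0, 1) with hBd
  set L := B⁻¹ • H'.comp (ContinuousLinearMap.inl ℝ F ℝ) with hL
  have htend : Tendsto (fun q => (q, a q)) (𝓝[s] p) (𝓝 (p, a p)) :=
    (tendsto_id.mono_left nhdsWithin_le_nhds).prodMk_nhds ha
  have h1 := (hasFDerivAt_iff_isLittleO.1 hH).comp_tendsto htend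
  have key : ∀ q ∈ s, a q - a p - L (q - p) =
      B⁻¹ * (H (q, a q) - H (p, a p) - H' ((q, a q) - (p, a p))) := by
    intro q hq
    rw [← heq q hq, ← heq p hp]
    have : H' ((q, a q) - (p, a p)) = H' (q - p, 0) + (a q - a p) * H' (0, 1) := by
      have e : ((q, a q) - (p, a p) : F × ℝ) = (q - p, 0) + (a q - a p) • ((0 : F), (1:ℝ)) := by
        ext <;> simp
      rw [e, map_add, map_smul, smul_eq_mul]
    rw [this]
    have e2 : L (q - p) = B⁻¹ * H' (q - p, 0) := by simp [hL]
    rw [e2]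
    have : H' (0,1) = 1 - B := by rw [hBd]; ring
    rw [this]
    field_simp
    ring
  have h2 : (fun q => a q - a p - L (q - p)) =o[𝓝[s] p] (fun q => ‖q - p‖ + ‖a q - a p‖) := by
    have h3 := h1.const_mul_left B⁻¹
    have h4 : (fun q => a q - a p - L (q - p)) =o[𝓝[s] p]
        ((fun x => x - (p, a p)) ∘ fun q => (q, a q)) := by
      refine h3.congr' ?_ EventuallyEq.rfl
      filter_upwards [self_mem_nhdsWithin] with q hq
      rw [key q hq]; rfl
    refine h4.trans_le ?_
    intro q
    simp only [Function.comp, Prod.mk_sub_mk, Prod.norm_mk]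
    rw [Real.norm_of_nonneg (r := ‖q - p‖ + ‖a q - a p‖) (by positivity)]
    exact max_le_add_of_nonneg (norm_nonneg _) (norm_nonneg _)
  have h5 : (fun q => a q - a p) =O[𝓝[s] p] (fun q => q - p) := by
    apply IsBigO.of_bound (2 * ‖L‖ + 1)
    filter_upwards [h2.bound (show (0:ℝ) < 1/2 by norm_num)] with q hq
    rw [Real.norm_of_nonneg (r := ‖q - p‖ + ‖a q - a p‖) (by positivity)] at hq
    have h6 : ‖a q - a p‖ ≤ ‖a q - a p - L (q - p)‖ + ‖L (q - p)‖ := by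
      simpa using norm_add_le (a q - a p - L (q - p)) (L (q - p))
    have h7 := L.le_opNorm (q - p)
    nlinarith
  have h8 : (fun q => ‖q - p‖ + ‖a q - a p‖) =O[𝓝[s] p] (fun q => q - p) :=
    (isBigO_refl (fun q => q - p) _).norm_left.add h5.norm_left
  exact hasFDerivWithinAt_iff_isLittleO.2 (h2.trans_isBigO h8)

/-- Standing data for the implicit description of the solution. -/
structure DriftData (f : E → ℝ) (γ c β T M : ℝ) (a : E × ℝ → ℝ) : Prop where
  hf : ContDiff ℝ 1 f
  hanti : ∀ x y : E, ‖x‖ ≤ ‖y‖ → f y ≤ f x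
  hnn : ∀ x, 0 ≤ f x
  hγ : 0 < γ
  hc : 0 < c
  hβ : 0 < β
  hM : 0 < M
  hT : c * T * M ^ γ = 1
  a0 : ∀ p ∈ (univ : Set E) ×ˢ Ico 0 T, 0 ≤ a p
  aM : ∀ p ∈ (univ : Set E) ×ˢ Ico 0 T, a p ≤ M
  aeq : ∀ p ∈ (univ : Set E) ×ˢ Ico 0 T, a p = f ((1 - c * p.2 * (a p) ^ γ) ^ (-β) • p.1)

variable {f : E → ℝ} {γ c β T M : ℝ} {a : E × ℝ → ℝ}

lemma DriftData.pos (D : DriftData f γ c β T M a) {p : E × ℝ}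
    (hp : p ∈ (univ : Set E) ×ˢ Ico 0 T) : 0 < 1 - c * p.2 * (a p) ^ γ :=
  drift_mm_pos D.hγ D.hc D.hM D.hT hp.2.1 hp.2.2 (D.a0 p hp) (D.aM p hp)

lemma DriftData.cont (D : DriftData f γ c β T M a) :
    ContinuousOn a ((univ : Set E) ×ˢ Ico 0 T) := by
  intro p hp
  have hpos := D.pos hp
  have hcont : ContinuousAt (fun q : E × ℝ => f ((1 - c * q.2 * (a p) ^ γ) ^ (-β) • q.1)) p := by
    apply D.hf.continuous.continuousAt.comp
    apply ContinuousAt.smul _ continuousAt_fst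
    apply ContinuousAt.rpow_const
    · fun_prop
    · exact Or.inl hpos.ne'
  have h1 : Tendsto (fun q : E × ℝ => |f ((1 - c * q.2 * (a p) ^ γ) ^ (-β) • q.1) - a p|)
      (𝓝[(univ : Set E) ×ˢ Ico 0 T] p) (𝓝 0) := by
    have := (hcont.tendsto.sub_const (a p)).abs
    rw [← D.aeq p hp, sub_self, abs_zero] at this
    exact this.mono_left nhdsWithin_le_nhds
  rw [ContinuousWithinAt, tendsto_iff_dist_tendsto_zero]
  refine squeeze_zero' (Eventually.of_forall fun _ => dist_nonneg) ?_ h1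
  filter_upwards [self_mem_nhdsWithin] with q hq
  rw [Real.dist_eq]
  have e := D.aeq q hq
  rcases le_total (a p) (a q) with h | h
  · have := drift_anti D.hanti D.hγ D.hc D.hβ D.hM D.hT hq.2.1 hq.2.2 (D.a0 p hp) h (D.aM q hq) q.1
    rw [← e] at this
    rw [abs_of_nonneg (by linarith)]
    exact le_trans (by linarith) (le_abs_self _)
  · have := drift_anti D.hanti D.hγ D.hc D.hβ D.hM D.hT hq.2.1 hq.2.2 (D.a0 q hq) h (D.aM p hp) q.1
    rw [← e] at this
    rw [abs_of_nonpos (by linarith)]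
    linarith [neg_le_abs (f ((1 - c * q.2 * (a p) ^ γ) ^ (-β) • q.1) - a p)]

/-- The foot of the characteristic. -/
noncomputable def dXi (γ c β : ℝ) (a : E × ℝ → ℝ) (p : E × ℝ) : E :=
  (1 - c * p.2 * (a p) ^ γ) ^ (-β) • p.1

noncomputable def dKap (f : E → ℝ) (γ c β : ℝ) (a : E × ℝ → ℝ) (p : E × ℝ) : ℝ :=
  β * c * γ * p.2 * (a p) ^ (γ - 1) / (1 - c * p.2 * (a p) ^ γ) *
    (-(fderiv ℝ f (dXi γ c β a p) (dXi γ c β a p)))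

noncomputable def dL (f : E → ℝ) (γ c β : ℝ) (a : E × ℝ → ℝ) (p : E × ℝ) : E × ℝ →L[ℝ] ℝ :=
  (1 + dKap f γ c β a p)⁻¹ • (fderiv ℝ f (dXi γ c β a p)).comp
    ((1 - c * p.2 * (a p) ^ γ) ^ (-β) • ContinuousLinearMap.fst ℝ E ℝ +
      (β * c * (a p) ^ γ / (1 - c * p.2 * (a p) ^ γ)) •
        (ContinuousLinearMap.snd ℝ E ℝ).smulRight (dXi γ c β a p))

lemma radial_fderiv_nonpos (hf : ContDiff ℝ 1 f)
    (hanti : ∀ x y : E, ‖x‖ ≤ ‖y‖ → f y ≤ f x) (ξ : E) : fderiv ℝ f ξ ξ ≤ 0 := by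
  have h1 : HasDerivAt (fun s : ℝ => f (s • ξ)) (fderiv ℝ f ξ ξ) 1 := by
    have h2 : HasFDerivAt f (fderiv ℝ f ξ) ((1:ℝ) • ξ) := by
      rw [one_smul]; exact (hf.differentiable one_ne_zero ξ).hasFDerivAt
    have h3 : HasDerivAt (fun s : ℝ => s • ξ) ξ 1 := by
      simpa using (hasDerivAt_id (1:ℝ)).smul_const ξ
    exact h2.comp_hasDerivAt 1 h3
  have h4 := h1.hasDerivWithinAt (s := Ici 0)
  have hu : derivWithin (fun s : ℝ => f (s • ξ)) (Ici 0) 1 = fderiv ℝ f ξ ξ :=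
    h4.derivWithin (uniqueDiffOn_Ici 0 1 (by simp))
  rw [← hu]
  apply AntitoneOn.derivWithin_nonpos
  intro s hs t ht hst
  apply hanti
  simp only [mem_Ici] at hs ht
  rw [norm_smul, norm_smul, Real.norm_of_nonneg hs, Real.norm_of_nonneg ht]
  gcongr

lemma fderiv_zero_of_zero (hnn : ∀ x, 0 ≤ f x) {ξ : E} (h : f ξ = 0) : fderiv ℝ f ξ = 0 := by
  apply IsLocalMin.fderiv_eq_zero
  filter_upwards with y
  rw [h]; exact hnn y

lemma DriftData.kap (D : DriftData f γ c β T M a) {p : E × ℝ}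
    (hp : p ∈ (univ : Set E) ×ˢ Ico 0 T) : 0 ≤ dKap f γ c β a p := by
  have hpos := D.pos hp
  have h0 := D.a0 p hp
  have ht := hp.2.1
  have hc := D.hc
  have hβ := D.hβ
  have hγ := D.hγ
  have := radial_fderiv_nonpos D.hf D.hanti (dXi γ c β a p)
  unfold dKap
  apply mul_nonneg
  · positivity
  · linarith

lemma DriftData.xi_eq (D : DriftData f γ c β T M a) {p : E × ℝ}
    (hp : p ∈ (univ : Set E) ×ˢ Ico 0 T) : f (dXi γ c β a p) = a p := (D.aeq p hp).symm

lemma DriftData.deriv_pos (D : DriftData f γ c β T M a) {p : E × ℝ}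
    (hp : p ∈ (univ : Set E) ×ˢ Ico 0 T) (hap : 0 < a p) :
    HasFDerivWithinAt a (dL f γ c β a p) ((univ : Set E) ×ˢ Ico 0 T) p := by
  have hpos := D.pos hp
  have hk := D.kap hp
  set m := 1 - c * p.2 * (a p) ^ γ with hm
  set ξ := dXi γ c β a p with hξ
  have hξ' : ξ = m ^ (-β) • p.1 := rfl
  -- derivative of the factor
  have h1 : HasFDerivAt (fun z : (E × ℝ) × ℝ => z.2 ^ γ)
      ((γ * (a p) ^ (γ - 1)) • ContinuousLinearMap.snd ℝ (E × ℝ) ℝ) (p, a p) :=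
    (hasFDerivAt_snd (𝕜 := ℝ) (p := (p, a p))).rpow_const (Or.inl hap.ne')
  have h2 : HasFDerivAt (fun z : (E × ℝ) × ℝ => z.1.2)
      ((ContinuousLinearMap.snd ℝ E ℝ).comp (ContinuousLinearMap.fst ℝ (E × ℝ) ℝ)) (p, a p) :=
    ((ContinuousLinearMap.snd ℝ E ℝ).comp (ContinuousLinearMap.fst ℝ (E × ℝ) ℝ)).hasFDerivAt
  have h2' : HasFDerivAt (fun z : (E × ℝ) × ℝ => z.1.1)
      ((ContinuousLinearMap.fst ℝ E ℝ).comp (ContinuousLinearMap.fst ℝ (E × ℝ) ℝ)) (p, a p) :=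
    ((ContinuousLinearMap.fst ℝ E ℝ).comp (ContinuousLinearMap.fst ℝ (E × ℝ) ℝ)).hasFDerivAt
  have h3 := ((h2.const_mul c).mul h1).const_sub 1
  have h4 := h3.rpow_const (p := -β) (Or.inl hpos.ne')
  have h5 := h4.smul h2'
  have h6 : HasFDerivAt f (fderiv ℝ f ξ) ξ := (D.hf.differentiable one_ne_zero ξ).hasFDerivAt
  have h7 := HasFDerivAt.comp (p, a p) (g := f) h6 h5
  have hmp : m ^ (-β - 1) = m ^ (-β) / m := Real.rpow_sub_one hpos.ne' _
  have hBv : ∀ w : E × ℝ, ∀ τ : ℝ, ((fderiv ℝ f ξ).comp ((1 - c * p.2 * a p ^ γ) ^ (-β) •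
      ((ContinuousLinearMap.fst ℝ E ℝ).comp (ContinuousLinearMap.fst ℝ (E × ℝ) ℝ)) +
      ((-β * (1 - c * p.2 * a p ^ γ) ^ (-β - 1)) • -((c * p.2) • ((γ * (a p) ^ (γ - 1)) • ContinuousLinearMap.snd ℝ (E × ℝ) ℝ) +
        (a p ^ γ) • (c • ((ContinuousLinearMap.snd ℝ E ℝ).comp (ContinuousLinearMap.fst ℝ (E × ℝ) ℝ))))).smulRight p.1)) (w, τ)
      = m ^ (-β) * fderiv ℝ f ξ w.1 + (β * c * a p ^ γ / m) * w.2 * fderiv ℝ f ξ ξ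
        - dKap f γ c β a p * τ := by
    intro w τ
    simp only [dKap, ← hm, ← hξ]
    simp [hξ', hmp, -neg_mul]
    field_simp
    ring
  have hB1 : 1 + dKap f γ c β a p ≠ 0 := by positivity
  obtain ⟨H', hH, hH'⟩ : ∃ H' : (E × ℝ) × ℝ →L[ℝ] ℝ,
      HasFDerivAt (fun z : (E × ℝ) × ℝ => f ((1 - c * z.1.2 * z.2 ^ γ) ^ (-β) • z.1.1)) H' (p, a p) ∧
      ∀ w : E × ℝ, ∀ τ : ℝ, H' (w, τ) = m ^ (-β) * fderiv ℝ f ξ w.1 +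
        (β * c * a p ^ γ / m) * w.2 * fderiv ℝ f ξ ξ - dKap f γ c β a p * τ :=
    ⟨_, h7, fun w τ => hBv w τ⟩
  have hBv1 : H' (0, 1) = - dKap f γ c β a p := by rw [hH']; simp
  have hB := implicit_deriv (a := a) hp (D.cont p hp) D.aeq hH
    (by rw [hBv1, sub_neg_eq_add]; exact hB1)
  refine hB.congr_fderiv ?_
  refine ContinuousLinearMap.ext fun w => ?_
  have hw := hH' w 0
  rw [hBv1]
  simp only [dL, ← hm, ← hξ]
  simp [hw]
  ring

lemma DriftData.a_le (D : DriftData f γ c β T M a) {p : E × ℝ}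
    (hp : p ∈ (univ : Set E) ×ˢ Ico 0 T) : a p ≤ f p.1 := by
  have hγ := D.hγ
  have := drift_anti D.hanti D.hγ D.hc D.hβ D.hM D.hT hp.2.1 hp.2.2 le_rfl (D.a0 p hp)
    (D.aM p hp) p.1
  rw [← D.aeq p hp, Real.zero_rpow hγ.ne'] at this
  simpa using this

lemma DriftData.f_zero (D : DriftData f γ c β T M a) {p : E × ℝ}
    (hp : p ∈ (univ : Set E) ×ˢ Ico 0 T) (hap : a p = 0) : f p.1 = 0 := by
  have := D.aeq p hp
  rw [hap, Real.zero_rpow D.hγ.ne'] at this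
  simpa using this.symm

lemma DriftData.dL_zero (D : DriftData f γ c β T M a) {p : E × ℝ}
    (hp : p ∈ (univ : Set E) ×ˢ Ico 0 T) (hap : a p = 0) : dL f γ c β a p = 0 := by
  have h : fderiv ℝ f (dXi γ c β a p) = 0 :=
    fderiv_zero_of_zero D.hnn ((D.xi_eq hp).trans hap)
  simp [dL, h]

lemma DriftData.deriv_zero (D : DriftData f γ c β T M a) {p : E × ℝ}
    (hp : p ∈ (univ : Set E) ×ˢ Ico 0 T) (hap : a p = 0) :
    a =o[𝓝[(univ : Set E) ×ˢ Ico 0 T] p] (fun q => q - p) := by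
  have hf0 := D.f_zero hp hap
  have h1 : HasFDerivAt f (fderiv ℝ f p.1) p.1 :=
    (D.hf.differentiable one_ne_zero p.1).hasFDerivAt
  rw [fderiv_zero_of_zero D.hnn hf0] at h1
  have h2 := hasFDerivAt_iff_isLittleO.1 h1
  simp only [hf0, zero_apply, sub_zero] at h2
  have h3 : Tendsto (fun q : E × ℝ => q.1) (𝓝[(univ : Set E) ×ˢ Ico 0 T] p) (𝓝 p.1) :=
    continuousAt_fst.tendsto.mono_left nhdsWithin_le_nhds
  have h4 := h2.comp_tendsto h3
  have h5 : (fun q : E × ℝ => f q.1) =o[𝓝[(univ : Set E) ×ˢ Ico 0 T] p] (fun q => q - p) := by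
    refine h4.trans_le fun q => ?_
    exact norm_fst_le (q - p)
  refine IsBigO.trans_isLittleO (IsBigO.of_bound 1 ?_) h5
  filter_upwards [self_mem_nhdsWithin] with q hq
  rw [Real.norm_of_nonneg (D.a0 q hq), Real.norm_of_nonneg (D.hnn _), one_mul]
  exact D.a_le hq

lemma DriftData.cont_mm (D : DriftData f γ c β T M a) :
    ContinuousOn (fun p => 1 - c * p.2 * (a p) ^ γ) ((univ : Set E) ×ˢ Ico 0 T) := by
  apply continuousOn_const.sub
  apply ContinuousOn.mul (by fun_prop)
  exact D.cont.rpow_const fun _ _ => Or.inr D.hγ.le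

lemma DriftData.cont_mmr (D : DriftData f γ c β T M a) (r : ℝ) :
    ContinuousOn (fun p => (1 - c * p.2 * (a p) ^ γ) ^ r) ((univ : Set E) ×ˢ Ico 0 T) :=
  D.cont_mm.rpow_const fun _ hp => Or.inl (D.pos hp).ne'

lemma DriftData.cont_xi (D : DriftData f γ c β T M a) :
    ContinuousOn (dXi γ c β a) ((univ : Set E) ×ˢ Ico 0 T) :=
  (D.cont_mmr (-β)).smul continuousOn_fst

lemma DriftData.cont_inner (D : DriftData f γ c β T M a) :
    ContinuousOn (fun p => (fderiv ℝ f (dXi γ c β a p)).comp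
    ((1 - c * p.2 * (a p) ^ γ) ^ (-β) • ContinuousLinearMap.fst ℝ E ℝ +
      (β * c * (a p) ^ γ / (1 - c * p.2 * (a p) ^ γ)) •
        (ContinuousLinearMap.snd ℝ E ℝ).smulRight (dXi γ c β a p)))
      ((univ : Set E) ×ˢ Ico 0 T) := by
  have h1 : ContinuousOn (fun p => fderiv ℝ f (dXi γ c β a p)) ((univ : Set E) ×ˢ Ico 0 T) :=
    (D.hf.continuous_fderiv one_ne_zero).comp_continuousOn D.cont_xi
  apply h1.clm_comp
  apply ContinuousOn.add
  · exact (D.cont_mmr (-β)).smul continuousOn_const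
  · apply ContinuousOn.fun_smul
    · apply ContinuousOn.div
      · apply continuousOn_const.mul
        exact D.cont.rpow_const fun _ _ => Or.inr D.hγ.le
      · exact D.cont_mm
      · intro p hp; exact (D.pos hp).ne'
    · exact ((ContinuousLinearMap.smulRightL ℝ (E × ℝ) E
        (ContinuousLinearMap.snd ℝ E ℝ)).continuous.comp_continuousOn D.cont_xi)

lemma DriftData.cont_dL (D : DriftData f γ c β T M a) :
    ContinuousOn (dL f γ c β a) ((univ : Set E) ×ˢ Ico 0 T) := by
  intro p hp
  have hin := D.cont_inner p hp
  rcases (D.a0 p hp).eq_or_lt with h0 | h0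
  · rw [ContinuousWithinAt, D.dL_zero hp h0.symm]
    have hz : fderiv ℝ f (dXi γ c β a p) = 0 :=
      fderiv_zero_of_zero D.hnn ((D.xi_eq hp).trans h0.symm)
    rw [ContinuousWithinAt, hz, ContinuousLinearMap.zero_comp] at hin
    refine squeeze_zero_norm' ?_ (tendsto_zero_iff_norm_tendsto_zero.1 hin)
    filter_upwards [self_mem_nhdsWithin] with q hq
    have hk := D.kap hq
    unfold dL
    rw [norm_smul]
    refine mul_le_of_le_one_left (norm_nonneg _) ?_
    rw [norm_inv, Real.norm_of_nonneg (by positivity)]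
    exact inv_le_one_of_one_le₀ (by linarith)
  · unfold dL
    refine ContinuousWithinAt.fun_smul ?_ hin
    have hk := D.kap hp
    apply ContinuousWithinAt.inv₀ _ (by positivity)
    apply continuousWithinAt_const.add
    unfold dKap
    have h1 : ContinuousOn (fun p => fderiv ℝ f (dXi γ c β a p)) ((univ : Set E) ×ˢ Ico 0 T) :=
      (D.hf.continuous_fderiv one_ne_zero).comp_continuousOn D.cont_xi
    apply ContinuousWithinAt.mul
    · apply ContinuousWithinAt.div
      · apply ContinuousWithinAt.mul (by fun_prop)
        exact (D.cont p hp).rpow_const (Or.inl h0.ne')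
      · exact D.cont_mm p hp
      · exact (D.pos hp).ne'
    · exact (ContinuousOn.clm_apply h1 D.cont_xi p hp).neg

/-- The solution. -/
noncomputable def dRho (γ c : ℝ) (a : E × ℝ → ℝ) (p : E × ℝ) : ℝ :=
  a p * (1 - c * p.2 * (a p) ^ γ) ^ (-γ⁻¹)

noncomputable def dRho' (f : E → ℝ) (γ c β : ℝ) (a : E × ℝ → ℝ) (p : E × ℝ) : E × ℝ →L[ℝ] ℝ :=
  (1 - c * p.2 * (a p) ^ γ) ^ (-γ⁻¹ - 1) • dL f γ c β a p +
  (γ⁻¹ * c * (a p) ^ (1 + γ) * (1 - c * p.2 * (a p) ^ γ) ^ (-γ⁻¹ - 1)) •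
    ContinuousLinearMap.snd ℝ E ℝ

lemma DriftData.cont_dRho' (D : DriftData f γ c β T M a) :
    ContinuousOn (dRho' f γ c β a) ((univ : Set E) ×ˢ Ico 0 T) := by
  have hγ := D.hγ
  apply ContinuousOn.add
  · exact (D.cont_mmr _).smul D.cont_dL
  · apply ContinuousOn.fun_smul _ continuousOn_const
    apply ContinuousOn.mul _ (D.cont_mmr _)
    apply continuousOn_const.mul
    exact D.cont.rpow_const fun _ _ => Or.inr (by positivity)

lemma DriftData.deriv_rho (D : DriftData f γ c β T M a) {p : E × ℝ}
    (hp : p ∈ (univ : Set E) ×ˢ Ico 0 T) :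
    HasFDerivWithinAt (dRho γ c a) (dRho' f γ c β a p) ((univ : Set E) ×ˢ Ico 0 T) p := by
  have hγ := D.hγ
  have hpos := D.pos hp
  rcases (D.a0 p hp).eq_or_lt with h0 | h0
  · have e : dRho' f γ c β a p = 0 := by
      have : (0:ℝ) ^ (1 + γ) = 0 := Real.zero_rpow (by positivity)
      simp [dRho', D.dL_zero hp h0.symm, ← h0, this]
    rw [e, hasFDerivWithinAt_iff_isLittleO]
    have e2 : dRho γ c a p = 0 := by simp [dRho, ← h0]
    simp only [e2, sub_zero, zero_apply]
    have h1 := D.deriv_zero hp h0.symm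
    have h2 : (fun q => (1 - c * q.2 * (a q) ^ γ) ^ (-γ⁻¹)) =O[𝓝[(univ : Set E) ×ˢ Ico 0 T] p]
        (fun _ => (1:ℝ)) := (D.cont_mmr (-γ⁻¹) p hp).isBigO_one ℝ
    have h3 := (h1.norm_right).mul_isBigO h2
    simp only [mul_one] at h3
    exact h3.of_norm_right
  · have h1 := D.deriv_pos hp h0
    have h2 := h1.rpow_const (p := γ) (Or.inl h0.ne')
    have hs : HasFDerivWithinAt (fun q : E × ℝ => q.2) (ContinuousLinearMap.snd ℝ E ℝ)
      ((univ : Set E) ×ˢ Ico 0 T) p := hasFDerivWithinAt_snd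
    have h3 := ((hs.const_mul c).mul h2).const_sub 1
    have h4 := h3.rpow_const (p := -γ⁻¹) (Or.inl hpos.ne')
    refine (h1.mul h4).congr_fderiv ?_
    refine ContinuousLinearMap.ext fun w => ?_
    have hmp : (1 - c * p.2 * (a p) ^ γ) ^ (-γ⁻¹) =
        (1 - c * p.2 * (a p) ^ γ) ^ (-γ⁻¹ - 1) * (1 - c * p.2 * (a p) ^ γ) := by
      rw [Real.rpow_sub_one hpos.ne']; field_simp
    have ha1 : (a p) ^ (γ - 1) = (a p) ^ γ / a p := Real.rpow_sub_one h0.ne' _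
    have ha2 : (a p) ^ (1 + γ) = a p * (a p) ^ γ := by
      rw [Real.rpow_add h0, Real.rpow_one]
    simp only [dRho', add_apply, smul_apply,
      neg_apply, smul_eq_mul, Pi.mul_apply, ContinuousLinearMap.coe_snd']
    rw [hmp, ha1, ha2]
    generalize (1 - c * p.2 * (a p) ^ γ) ^ (-γ⁻¹ - 1) = Q
    field_simp
    ring

lemma DriftData.transport (D : DriftData f γ c β T M a) {p : E × ℝ}
    (hp : p ∈ (univ : Set E) ×ˢ Ico 0 T) :
    dL f γ c β a p (0, 1) - β * c * (a p ^ γ / (1 - c * p.2 * (a p) ^ γ)) * dL f γ c β a p (p.1, 0)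
      = 0 := by
  have hpos := D.pos hp
  simp [dL, dXi]
  field_simp
  ring

lemma DriftData.rho_pow (D : DriftData f γ c β T M a) {p : E × ℝ}
    (hp : p ∈ (univ : Set E) ×ˢ Ico 0 T) :
    dRho γ c a p ^ γ = a p ^ γ / (1 - c * p.2 * (a p) ^ γ) := by
  have hpos := D.pos hp
  have hγ := D.hγ
  unfold dRho
  rw [Real.mul_rpow (D.a0 p hp) (by positivity), ← Real.rpow_mul hpos.le,
    neg_mul, inv_mul_cancel₀ hγ.ne', Real.rpow_neg_one, div_eq_mul_inv]

lemma DriftData.rho_pow1 (D : DriftData f γ c β T M a) {p : E × ℝ}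
    (hp : p ∈ (univ : Set E) ×ˢ Ico 0 T) :
    dRho γ c a p ^ (1 + γ) = a p ^ (1 + γ) * (1 - c * p.2 * (a p) ^ γ) ^ (-γ⁻¹ - 1) := by
  have hpos := D.pos hp
  have hγ := D.hγ
  unfold dRho
  rw [Real.mul_rpow (D.a0 p hp) (by positivity), ← Real.rpow_mul hpos.le]
  congr 2
  field_simp
  ring

lemma DriftData.pde (D : DriftData f γ c β T M a) {d : ℝ} (hcd : c = γ * d)
    (hβc : β * c = 1 + γ) {p : E × ℝ}
    (hp : p ∈ (univ : Set E) ×ˢ Ico 0 T) :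
    dRho' f γ c β a p (0, 1) - (1 + γ) * dRho γ c a p ^ γ * dRho' f γ c β a p (p.1, 0)
      = d * dRho γ c a p ^ (1 + γ) := by
  have hγ := D.hγ
  have h := D.transport hp
  rw [D.rho_pow hp, D.rho_pow1 hp]
  have hd : d = γ⁻¹ * c := by rw [hcd]; field_simp
  simp only [dRho', add_apply, smul_apply,
    smul_eq_mul, ContinuousLinearMap.coe_snd', hd]
  rw [hβc] at h
  linear_combination (1 - c * p.2 * (a p) ^ γ) ^ (-γ⁻¹ - 1) * h

end Aux

section Scalar
open Topology

lemma scalar_unique {T γ d : ℝ} {u v A : ℝ → ℝ} (hγ : 0 < γ) (hd : 0 ≤ d)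
    (hu : ∀ t ∈ Ico 0 T, HasDerivWithinAt u
      (d * u t ^ (1 + γ) + (1 + γ) * (u t ^ γ - v t ^ γ) * A t) (Ico 0 T) t)
    (hv : ∀ t ∈ Ico 0 T, HasDerivWithinAt v (d * v t ^ (1 + γ)) (Ico 0 T) t)
    (hvpos : ∀ t ∈ Ico 0 T, 0 < v t) (hA : ContinuousOn A (Ico 0 T)) (h0 : u 0 = v 0) :
    ∀ t ∈ Ico 0 T, u t = v t := by
  intro t₁ ht₁
  have huc : ContinuousOn u (Ico 0 T) := fun t ht => (hu t ht).continuousWithinAt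
  have hvc : ContinuousOn v (Ico 0 T) := fun t ht => (hv t ht).continuousWithinAt
  have hsub : Icc 0 t₁ ⊆ Ico 0 T := fun t ht => ⟨ht.1, ht.2.trans_lt ht₁.2⟩
  have hclosed : IsClosed ({t | u t = v t} ∩ Icc 0 t₁) := by
    have := ((huc.mono hsub).sub (hvc.mono hsub)).preimage_isClosed_of_isClosed isClosed_Icc
      (isClosed_singleton (x := (0:ℝ)))
    convert! this using 1
    ext t
    simp [sub_eq_zero, and_comm]
  refine hclosed.Icc_subset_of_forall_mem_nhdsWithin h0 ?_ (⟨ht₁.1, le_rfl⟩ : t₁ ∈ Icc 0 t₁)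
  rintro x ⟨hx, hx1⟩
  have hxT : x ∈ Ico 0 T := hsub ⟨hx1.1, hx1.2.le⟩
  have hpos := hvpos x hxT
  obtain ⟨K1, s1, hs1, hK1⟩ : ∃ K, ∃ s ∈ 𝓝 (v x), LipschitzOnWith K (fun y : ℝ => y ^ (1 + γ)) s :=
    (Real.contDiffAt_rpow_const_of_ne (n := 1) hpos.ne').exists_lipschitzOnWith
  obtain ⟨K2, s2, hs2, hK2⟩ : ∃ K, ∃ s ∈ 𝓝 (v x), LipschitzOnWith K (fun y : ℝ => y ^ γ) s :=
    (Real.contDiffAt_rpow_const_of_ne (n := 1) hpos.ne').exists_lipschitzOnWith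
  have hle : 𝓝[≥] x ≤ 𝓝[Ico 0 T] x := by
    rw [← nhdsWithin_Ico_eq_nhdsGE hxT.2]
    exact nhdsWithin_mono _ (Ico_subset_Ico_left hxT.1)
  have hx' : u x = v x := hx
  have ev : {t | u t ∈ s1 ∩ s2 ∧ v t ∈ s1 ∩ s2 ∧ |A t| < |A x| + 1 ∧ t ∈ Ico 0 T} ∈ 𝓝[≥] x := by
    apply hle
    have e1 := (huc x hxT).tendsto.eventually (hx' ▸ inter_mem hs1 hs2)
    have e2 := (hvc x hxT).tendsto.eventually (inter_mem hs1 hs2)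
    have e3 := (hA x hxT).abs.tendsto.eventually (gt_mem_nhds (show |A x| < |A x| + 1 by linarith))
    filter_upwards [e1, e2, e3, self_mem_nhdsWithin] with t a1 a2 a3 a4
    exact ⟨a1, a2, a3, a4⟩
  obtain ⟨w, hxw, hw⟩ := mem_nhdsGE_iff_exists_Icc_subset.1 ev
  have hsubw : Icc x w ⊆ Ico 0 T := fun t ht => (hw ht).2.2.2
  have hder : ∀ {g : ℝ → ℝ} {g' t : ℝ}, t ∈ Ico x w → HasDerivWithinAt g g' (Ico 0 T) t →
      HasDerivWithinAt g g' (Ici t) t := by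
    intro g g' t ht h
    have htT := hsubw ⟨ht.1, ht.2.le⟩
    refine h.mono_of_mem_nhdsWithin ?_
    rw [← nhdsWithin_Ico_eq_nhdsGE htT.2]
    exact mem_of_superset self_mem_nhdsWithin (Ico_subset_Ico_left htT.1)
  have huniq : EqOn u v (Icc x w) := by
    refine ODE_solution_unique_of_mem_Icc_right
      (v := fun t y => d * y ^ (1 + γ) + (1 + γ) * (y ^ γ - v t ^ γ) * A t)
      (s := fun _ => s1 ∩ s2) (K := Real.toNNReal (d * K1 + (1 + γ) * K2 * (|A x| + 1)))
      ?_ (huc.mono hsubw) ?_ ?_ (hvc.mono hsubw) ?_ ?_ hx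
    · intro t ht
      have hA' := (hw ⟨ht.1, ht.2.le⟩).2.2.1
      refine LipschitzOnWith.of_dist_le_mul fun y hy z hz => ?_
      rw [Real.coe_toNNReal _ (by positivity)]
      have i1 := hK1.dist_le_mul y hy.1 z hz.1
      have i2 := hK2.dist_le_mul y hy.2 z hz.2
      simp only [Real.dist_eq] at i1 i2 ⊢
      have e : d * y ^ (1 + γ) + (1 + γ) * (y ^ γ - v t ^ γ) * A t -
          (d * z ^ (1 + γ) + (1 + γ) * (z ^ γ - v t ^ γ) * A t)
          = d * (y ^ (1 + γ) - z ^ (1 + γ)) + (1 + γ) * (y ^ γ - z ^ γ) * A t := by ring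
      rw [e]
      refine (abs_add_le _ _).trans ?_
      rw [abs_mul, abs_mul, abs_mul, abs_of_nonneg hd, abs_of_pos (show 0 < 1 + γ by linarith)]
      have i3 : d * |y ^ (1 + γ) - z ^ (1 + γ)| ≤ d * (K1 * |y - z|) :=
        mul_le_mul_of_nonneg_left i1 hd
      have i4 : (1 + γ) * |y ^ γ - z ^ γ| * |A t| ≤ (1 + γ) * (K2 * |y - z|) * (|A x| + 1) := by
        gcongr
      linarith
    · intro t ht
      exact hder ht (hu t (hsubw ⟨ht.1, ht.2.le⟩))
    · intro t ht; exact (hw ⟨ht.1, ht.2.le⟩).1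
    · intro t ht
      refine (hder ht (hv t (hsubw ⟨ht.1, ht.2.le⟩))).congr_deriv ?_
      ring
    · intro t ht; exact (hw ⟨ht.1, ht.2.le⟩).2.1
  refine mem_of_superset (Icc_mem_nhdsGT hxw) fun t ht => huniq ht

end Scalar

section Main
open Topology

variable {d : ℕ}

lemma partials {T : ℝ} {ρ : EuclideanSpace ℝ (Fin d) × ℝ → ℝ}
    {L : EuclideanSpace ℝ (Fin d) × ℝ →L[ℝ] ℝ} {x : EuclideanSpace ℝ (Fin d)} {t : ℝ}
    (ht : t ∈ Ico 0 T)
    (h : HasFDerivWithinAt ρ L (univ ×ˢ Ico 0 T) (x, t)) :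
    derivWithin (fun s => ρ (x, s)) (Ico 0 T) t = L (0, 1) ∧
    inner (𝕜 := ℝ) x (gradient (fun y => ρ (y, t)) x) = L (x, 0) := by
  constructor
  · have h1 : HasDerivWithinAt (fun s : ℝ => (x, s)) ((0 : EuclideanSpace ℝ (Fin d)), (1:ℝ))
        (Ico 0 T) t :=
      (hasDerivWithinAt_const _ _ _).prodMk (hasDerivWithinAt_id _ _)
    have h2 := h.comp_hasDerivWithinAt (f := fun s : ℝ => (x, s)) t h1
      (fun s hs => (⟨mem_univ _, hs⟩ : (x, s) ∈ univ ×ˢ Ico 0 T))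
    exact h2.derivWithin (uniqueDiffOn_Ico 0 T t ht)
  · have h1 : HasFDerivWithinAt (fun y : EuclideanSpace ℝ (Fin d) => (y, t))
        (ContinuousLinearMap.inl ℝ _ ℝ) univ x :=
      (hasFDerivAt_prodMk_left x t).hasFDerivWithinAt
    have h2 := h.comp (f := fun y : EuclideanSpace ℝ (Fin d) => (y, t)) x h1
      (fun y _ => (⟨mem_univ _, ht⟩ : (y, t) ∈ univ ×ˢ Ico 0 T))
    have h3 := (hasFDerivWithinAt_univ.1 h2).fderiv
    rw [inner_gradient_right]
    simp only [conj_trivial]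
    erw [h3]
    simp

lemma char_unique {γ c β T b : ℝ} {f : EuclideanSpace ℝ (Fin d) → ℝ}
    {ρ : EuclideanSpace ℝ (Fin d) × ℝ → ℝ} (hγ : 0 < γ) (hcd : c = γ * d) (hβc : β * c = 1 + γ)
    (hρ : IsC1DriftSol d γ f T ρ) (ξ : EuclideanSpace ℝ (Fin d)) (hb : b = f ξ) (hb0 : 0 < b)
    (hm : ∀ t ∈ Ico 0 T, 0 < 1 - c * t * b ^ γ) :
    ∀ t ∈ Ico 0 T, ρ ((1 - c * t * b ^ γ) ^ β • ξ, t) = b * (1 - c * t * b ^ γ) ^ (-γ⁻¹) := by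
  obtain ⟨hC, hi, hpde⟩ := hρ
  set s : Set (EuclideanSpace ℝ (Fin d) × ℝ) := univ ×ˢ Ico 0 T with hs
  set X : ℝ → EuclideanSpace ℝ (Fin d) := fun t => (1 - c * t * b ^ γ) ^ β • ξ with hX
  set v : ℝ → ℝ := fun t => b * (1 - c * t * b ^ γ) ^ (-γ⁻¹) with hvdef
  have hmd : ∀ t, HasDerivAt (fun t : ℝ => 1 - c * t * b ^ γ) (- (c * b ^ γ)) t := by
    intro t
    have := ((hasDerivAt_id t).const_mul c).mul_const (b ^ γ) |>.const_sub 1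
    simpa using this
  have hvpow : ∀ t ∈ Ico 0 T, v t ^ γ = b ^ γ / (1 - c * t * b ^ γ) := by
    intro t ht
    have := hm t ht
    simp only [hvdef]
    rw [Real.mul_rpow hb0.le (by positivity), ← Real.rpow_mul this.le,
      neg_mul, inv_mul_cancel₀ hγ.ne', Real.rpow_neg_one, div_eq_mul_inv]
  have hvpos : ∀ t ∈ Ico 0 T, 0 < v t := by
    intro t ht
    have := hm t ht
    simp only [hvdef]
    positivity
  have hvd : ∀ t ∈ Ico 0 T, HasDerivWithinAt v (d * v t ^ (1 + γ)) (Ico 0 T) t := by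
    intro t ht
    have hp := hm t ht
    have h1 := ((hmd t).rpow_const (p := -γ⁻¹) (Or.inl hp.ne')).const_mul b
    refine h1.hasDerivWithinAt.congr_deriv ?_
    rw [Real.rpow_add (hvpos t ht), Real.rpow_one, hvpow t ht]
    simp only [hvdef]
    rw [Real.rpow_sub_one hp.ne', hcd]
    field_simp
  have hXd : ∀ t ∈ Ico 0 T, HasDerivWithinAt X (-((1 + γ) * v t ^ γ) • X t) (Ico 0 T) t := by
    intro t ht
    have hp := hm t ht
    have h1 := ((hmd t).rpow_const (p := β) (Or.inl hp.ne')).smul_const ξ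
    refine h1.hasDerivWithinAt.congr_deriv ?_
    rw [hvpow t ht, ← hβc]
    simp only [hX, smul_smul]
    congr 1
    rw [Real.rpow_sub_one hp.ne']
    field_simp
  have hmaps : ∀ t ∈ Ico 0 T, (X t, t) ∈ s := fun t ht => ⟨mem_univ _, ht⟩
  have hfd : ∀ p ∈ s, HasFDerivWithinAt ρ (fderivWithin ℝ ρ s p) s p := fun p hp =>
    (hC.differentiableOn one_ne_zero p hp).hasFDerivWithinAt
  have hXc : ContinuousOn X (Ico 0 T) := fun t ht => (hXd t ht).continuousWithinAt
  have hud : UniqueDiffOn ℝ s := uniqueDiffOn_univ.prod (uniqueDiffOn_Ico 0 T)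
  have hAc : ContinuousOn (fun t => - fderivWithin ℝ ρ s (X t, t) (- X t, 0)) (Ico 0 T) := by
    have h1 : ContinuousOn (fun t => fderivWithin ℝ ρ s (X t, t)) (Ico 0 T) :=
      (hC.continuousOn_fderivWithin hud le_rfl).comp (hXc.prodMk continuousOn_id) hmaps
    exact (h1.clm_apply (hXc.neg.prodMk continuousOn_const)).neg
  refine scalar_unique (u := fun t => ρ (X t, t)) (v := v) hγ (Nat.cast_nonneg d) ?_ hvd hvpos
    hAc ?_
  · intro t ht
    have h1 : HasDerivWithinAt (fun t => (X t, t)) (-((1 + γ) * v t ^ γ) • X t, (1:ℝ)) (Ico 0 T) t :=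
      (hXd t ht).prodMk (hasDerivWithinAt_id _ _)
    have h2 := (hfd _ (hmaps t ht)).comp_hasDerivWithinAt (f := fun t => (X t, t)) t h1 hmaps
    refine h2.congr_deriv ?_
    have h3 := hpde (X t) t ht
    obtain ⟨e1, e2⟩ := partials ht (hfd _ (hmaps t ht))
    rw [e1, e2] at h3
    have e3 : ((-((1 + γ) * v t ^ γ) • X t, (1:ℝ)) : EuclideanSpace ℝ (Fin d) × ℝ) =
      (0, 1) + (-((1 + γ) * v t ^ γ)) • (X t, 0) := by simp
    have e4 : ((- X t, (0:ℝ)) : EuclideanSpace ℝ (Fin d) × ℝ) = -(X t, 0) := by simp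
    rw [e3, map_add, map_smul, e4, map_neg, smul_eq_mul]
    linear_combination h3
  · simp [hX, hvdef, hi, hb]

/-- Blowup at the origin. -/
lemma blowup {γ c β T M : ℝ} {f : EuclideanSpace ℝ (Fin d) → ℝ}
    {a ρ : EuclideanSpace ℝ (Fin d) × ℝ → ℝ} (D : DriftData f γ c β T M a)
    (hM0 : f 0 = M) (hcd : c = γ * d) (hβc : β * c = 1 + γ)
    (hρ : IsC1DriftSol d γ f T ρ) :
    Tendsto ρ (𝓝[univ ×ˢ Ico 0 T] ((0 : EuclideanSpace ℝ (Fin d)), T)) atTop := by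
  have hγ := D.hγ
  have hc := D.hc
  have hM := D.hM
  have hval : ∀ p ∈ (univ : Set (EuclideanSpace ℝ (Fin d))) ×ˢ Ico 0 T, 0 < a p →
      ρ p = a p * (1 - c * p.2 * a p ^ γ) ^ (-γ⁻¹) := by
    rintro p hp h0
    have := char_unique hγ hcd hβc hρ (dXi γ c β a p) (D.xi_eq hp).symm h0
      (fun t ht => drift_mm_pos hγ hc hM D.hT ht.1 ht.2 (D.a0 p hp) (D.aM p hp)) p.2 hp.2
    rw [← this]
    unfold dXi
    have hpos := D.pos hp
    rw [smul_smul, ← Real.rpow_add hpos, add_neg_cancel, Real.rpow_zero, one_smul]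
  have hmpos : ∀ b, 0 < b → b < M → 0 < 1 - c * T * b ^ γ := by
    intro b hb hbM
    have h1 : b ^ γ < M ^ γ := Real.rpow_lt_rpow hb.le hbM hγ
    have h2 : 0 < M ^ γ := by positivity
    have hcT : 0 < c * T := by
      by_contra h
      have := mul_nonpos_of_nonpos_of_nonneg (not_lt.1 h) h2.le
      linarith [D.hT]
    have := mul_lt_mul_of_pos_left h1 hcT
    linarith [D.hT]
  have hev : ∀ᶠ b in 𝓝[<] M, 0 < b ∧ b < M := by
    have e1 : ∀ᶠ b in 𝓝[<] M, 0 < b := nhdsWithin_le_nhds (lt_mem_nhds hM)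
    filter_upwards [e1, self_mem_nhdsWithin] with b h1 h2 using ⟨h1, h2⟩
  have hlim : Tendsto (fun b => b * (1 - c * T * b ^ γ) ^ (-γ⁻¹)) (𝓝[<] M) atTop := by
    refine Tendsto.pos_mul_atTop hM (tendsto_id.mono_left nhdsWithin_le_nhds) ?_
    refine (tendsto_rpow_neg_nhdsGT_zero (y := -γ⁻¹) (by simpa using hγ)).comp ?_
    refine tendsto_nhdsWithin_iff.2 ⟨?_, ?_⟩
    · have h1 : ContinuousAt (fun b : ℝ => 1 - c * T * b ^ γ) M := by
        apply continuousAt_const.sub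
        apply continuousAt_const.mul
        exact Real.continuousAt_rpow_const _ _ (Or.inl hM.ne')
      have h2 := h1.tendsto
      simp only [D.hT, sub_self] at h2
      exact h2.mono_left nhdsWithin_le_nhds
    · filter_upwards [hev] with b hb using hmpos b hb.1 hb.2
  rw [tendsto_atTop]
  intro K
  obtain ⟨b, hbK, hb0, hbM⟩ := ((hlim.eventually_gt_atTop K).and hev).exists
  have hmb := hmpos b hb0 hbM
  have c1 : ContinuousAt (fun p : EuclideanSpace ℝ (Fin d) × ℝ =>
      b * (1 - c * p.2 * b ^ γ) ^ (-γ⁻¹)) (0, T) := by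
    apply continuousAt_const.mul
    apply ContinuousAt.rpow_const
    · fun_prop
    · exact Or.inl hmb.ne'
  have c2 : ContinuousAt (fun p : EuclideanSpace ℝ (Fin d) × ℝ =>
      f ((1 - c * p.2 * b ^ γ) ^ (-β) • p.1)) (0, T) := by
    apply D.hf.continuous.continuousAt.comp
    apply ContinuousAt.fun_smul _ continuousAt_fst
    apply ContinuousAt.rpow_const
    · fun_prop
    · exact Or.inl hmb.ne'
  have e1 := nhdsWithin_le_nhds (s := univ ×ˢ Ico 0 T) (c1.eventually_const_lt hbK)
  have e2 := nhdsWithin_le_nhds (s := univ ×ˢ Ico 0 T)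
    (c2.eventually_const_lt (u := b) (by simpa [hM0] using hbM))
  filter_upwards [e1, e2, self_mem_nhdsWithin] with p h1 h2 hp
  have hba : b ≤ a p := by
    by_contra h
    push Not at h
    have := drift_anti D.hanti hγ hc D.hβ hM D.hT hp.2.1 hp.2.2 (D.a0 p hp) h.le hbM.le p.1
    rw [← D.aeq p hp] at this
    linarith
  rw [hval p hp (hb0.trans_le hba)]
  refine h1.le.trans ?_
  have hpos := D.pos hp
  have hpow : b ^ γ ≤ a p ^ γ := Real.rpow_le_rpow hb0.le hba hγ.le
  have ht := hp.2.1
  have hmm : 1 - c * p.2 * a p ^ γ ≤ 1 - c * p.2 * b ^ γ := by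
    have : c * p.2 * b ^ γ ≤ c * p.2 * a p ^ γ := by gcongr
    linarith
  have : (1 - c * p.2 * b ^ γ) ^ (-γ⁻¹) ≤ (1 - c * p.2 * a p ^ γ) ^ (-γ⁻¹) :=
    Real.rpow_le_rpow_of_nonpos hpos hmm (by simpa using hγ.le)
  have hpos2 : 0 < 1 - c * p.2 * b ^ γ := hpos.trans_le hmm
  gcongr
  linarith

end Main

/-- For a radially symmetric, radially non-increasing, bounded `C¹` initial datum
`f_I ≥ 0` not identically zero, the maximal time of existence of the `C¹` solution of
the scaled drift equation is `t* = (γ d (sup f_I)^γ)⁻¹`, and the solution blows up at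
the origin: `ρ(x,t) → +∞` as `(x,t) → (0,t*)`. -/
theorem maximal_existence_time_and_blowup (d : ℕ) (hd : 1 ≤ d) (γ : ℝ) (hγ : 0 < γ)
    (f_I : EuclideanSpace ℝ (Fin d) → ℝ)
    (hC1 : ContDiff ℝ 1 f_I) (hbdd : ∃ C : ℝ, ∀ x, |f_I x| ≤ C)
    (hnn : ∀ x, 0 ≤ f_I x)
    (g : ℝ → ℝ) (hrad : ∀ x, f_I x = g ‖x‖) (hmono : AntitoneOn g (Ici 0))
    (hne : ∃ x, f_I x ≠ 0) :
    let tstar : ℝ := (γ * (d : ℝ) * (⨆ x, f_I x) ^ γ)⁻¹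
    (∃ ρ, IsC1DriftSol d γ f_I tstar ρ) ∧
    (∀ t' : ℝ, tstar < t' → ¬ ∃ ρ, IsC1DriftSol d γ f_I t' ρ) ∧
    (∀ ρ, IsC1DriftSol d γ f_I tstar ρ →
      Tendsto ρ (nhdsWithin ((0 : EuclideanSpace ℝ (Fin d)), tstar)
        (univ ×ˢ Ico 0 tstar)) atTop) := by
  intro tstar
  have hanti : ∀ x y : EuclideanSpace ℝ (Fin d), ‖x‖ ≤ ‖y‖ → f_I y ≤ f_I x := by
    intro x y hxy
    rw [hrad, hrad]
    exact hmono (norm_nonneg _) (norm_nonneg _) hxy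
  have hle0 : ∀ x, f_I x ≤ f_I 0 := fun x => hanti 0 x (by simp)
  have hsup : (⨆ x, f_I x) = f_I 0 :=
    le_antisymm (ciSup_le hle0) (le_ciSup (f := f_I) ⟨f_I 0, by rintro _ ⟨x, rfl⟩; exact hle0 x⟩ 0)
  have hM : 0 < f_I 0 := by
    obtain ⟨x, hx⟩ := hne
    exact ((hnn x).lt_of_ne' hx).trans_le (hle0 x)
  have hd0 : (0:ℝ) < d := by exact_mod_cast hd
  have hMγ : 0 < f_I 0 ^ γ := by positivity
  have htdef : tstar = (γ * (d : ℝ) * (f_I 0) ^ γ)⁻¹ := by rw [← hsup]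
  have htpos : 0 < tstar := by rw [htdef]; positivity
  have hT : γ * (d : ℝ) * tstar * f_I 0 ^ γ = 1 := by
    rw [htdef]; field_simp
  have hc : 0 < γ * (d : ℝ) := by positivity
  have hβ : 0 < (1 + γ) / (γ * (d : ℝ)) := by positivity
  have hβc : (1 + γ) / (γ * (d : ℝ)) * (γ * (d : ℝ)) = 1 + γ := by field_simp
  have hroot : ∀ p : EuclideanSpace ℝ (Fin d) × ℝ, ∃ a : ℝ, p ∈ (univ : Set (EuclideanSpace ℝ (Fin d))) ×ˢ Ico 0 tstar →
      0 ≤ a ∧ a ≤ f_I 0 ∧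
      a = f_I ((1 - (γ * (d : ℝ)) * p.2 * a ^ γ) ^ (-((1 + γ) / (γ * (d : ℝ)))) • p.1) := by
    intro p
    by_cases hp : p ∈ (univ : Set (EuclideanSpace ℝ (Fin d))) ×ˢ Ico 0 tstar
    · obtain ⟨a, ha⟩ := drift_root (β := (1 + γ) / (γ * (d : ℝ))) hC1.continuous hnn hle0 hγ hc hM hT
        hp.2.1 hp.2.2 p.1
      exact ⟨a, fun _ => ha⟩
    · exact ⟨0, fun h => absurd h hp⟩
  choose a ha using hroot
  have D : DriftData f_I γ (γ * (d : ℝ)) ((1 + γ) / (γ * (d : ℝ))) tstar (f_I 0) a :=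
    ⟨hC1, hanti, hnn, hγ, hc, hβ, hM, hT, fun p hp => (ha p hp).1, fun p hp => (ha p hp).2.1,
      fun p hp => (ha p hp).2.2⟩
  have hblow : ∀ ρ, IsC1DriftSol d γ f_I tstar ρ →
      Tendsto ρ (nhdsWithin ((0 : EuclideanSpace ℝ (Fin d)), tstar)
        (univ ×ˢ Ico 0 tstar)) atTop := fun ρ hρ => blowup D rfl rfl hβc hρ
  refine ⟨⟨dRho γ (γ * (d : ℝ)) a, ?_, ?_, ?_⟩, ?_, hblow⟩
  · have hud : UniqueDiffOn ℝ ((univ : Set (EuclideanSpace ℝ (Fin d))) ×ˢ Ico 0 tstar) :=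
      uniqueDiffOn_univ.prod (uniqueDiffOn_Ico 0 tstar)
    have h1 : ContDiffOn ℝ (0 + 1) (dRho γ (γ * (d : ℝ)) a) (univ ×ˢ Ico 0 tstar) := by
      refine contDiffOn_succ_of_fderivWithin
        (fun p hp => (D.deriv_rho hp).differentiableWithinAt) (by simp) ?_
      rw [contDiffOn_zero]
      exact D.cont_dRho'.congr fun p hp => (D.deriv_rho hp).fderivWithin (hud p hp)
    simpa using h1
  · intro x
    have := (ha (x, 0) ⟨mem_univ _, le_rfl, htpos⟩).2.2
    simp at this
    simp [dRho, this]
  · intro x t ht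
    have hp : (x, t) ∈ (univ : Set (EuclideanSpace ℝ (Fin d))) ×ˢ Ico 0 tstar := ⟨mem_univ _, ht⟩
    obtain ⟨e1, e2⟩ := partials ht (D.deriv_rho hp)
    rw [e1, e2]
    exact D.pde rfl hβc hp
  · rintro t' ht' ⟨ρ, hC, hi, hpde⟩
    have hsub : (univ : Set (EuclideanSpace ℝ (Fin d))) ×ˢ Ico 0 tstar ⊆ univ ×ˢ Ico 0 t' :=
      prod_mono_right (Ico_subset_Ico_right ht'.le)
    have hsol : IsC1DriftSol d γ f_I tstar ρ := by
      refine ⟨hC.mono hsub, hi, fun x t ht => ?_⟩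
      rw [← hpde x t ⟨ht.1, ht.2.trans ht'⟩]
      congr 1
      apply derivWithin_congr_set
      filter_upwards [gt_mem_nhds ht.2] with s hs
      apply propext
      exact ⟨fun h => ⟨h.1, h.2.trans ht'⟩, fun h => ⟨h.1, hs⟩⟩
    have h1 := hblow ρ hsol
    have h2 : Tendsto ρ (nhdsWithin ((0 : EuclideanSpace ℝ (Fin d)), tstar)
        (univ ×ˢ Ico 0 tstar)) (nhds (ρ (0, tstar))) :=
      (hC.continuousOn (0, tstar) ⟨mem_univ _, htpos.le, ht'⟩).mono hsub
    have hne : (nhdsWithin ((0 : EuclideanSpace ℝ (Fin d)), tstar)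
        (univ ×ˢ Ico 0 tstar)).NeBot := by
      rw [← mem_closure_iff_nhdsWithin_neBot, closure_prod_eq, closure_Ico htpos.ne]
      exact ⟨by simp, htpos.le, le_rfl⟩
    exact not_tendsto_nhds_of_tendsto_atTop h1 _ h2
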